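/- Convergence to equilibrium under the stability condition: assume H has compact sublevel sets and attains its minimum 0 at a unique point c₀ ∈ ℝ^N × ℝ^N, and assume the stability condition: every differentiable pair of curves q, p : ℝ → ℝ^N satisfying q_i′ = p_i and p_i′ = −∂_{q_i}H(q,p) for all i ∈ V, together with p_i(t) = 0 for every i ∈ D and every t ∈ ℝ, is constant equal to c₀. Then every differentiable solution (q,p) : [0,∞) → ℝ^N × ℝ^N of the damped system q_i′ = p_i, p_i′ = −∂_{q_i}H(q,p) − 1_{i∈D} p_i converges to c₀ as t → ∞. -/

import Mathlib

open Filter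

/-- The Hamiltonian `H(q,p) = Σ_i ( p_i²/2 + V(q_i) + (1/2) Σ_{j∼i} U(q_i − q_j) )`. -/
noncomputable def hamiltonian {N : ℕ} (G : SimpleGraph (Fin N)) [DecidableRel G.Adj]
    (U V : ℝ → ℝ) : (Fin N → ℝ) × (Fin N → ℝ) → ℝ :=
  fun w => ∑ i : Fin N,
    (w.2 i ^ 2 / 2 + V (w.1 i) + (1 / 2) * ∑ j ∈ G.neighborFinset i, U (w.1 i - w.1 j))

open scoped Topology

/-- Along an ultrafilter finer than `atTop`, the time translates of a solution of an autonomous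
differential equation that stays in a compact set converge pointwise to a solution defined for
all times. -/
theorem exists_limit_solution {E : Type*} [NormedAddCommGroup E] [NormedSpace ℝ E]
    {F : E → E} (hF : Continuous F) {K : Set E} (hK : IsCompact K) {x : ℝ → E}
    (hxK : ∀ t, 0 ≤ t → x t ∈ K) (hx : ∀ t, 0 ≤ t → HasDerivAt x (F (x t)) t)
    (g : Ultrafilter ℝ) (hg : (g : Filter ℝ) ≤ atTop) :
    ∃ y : ℝ → E, ∀ s, Tendsto (fun t => x (t + s)) g (𝓝 (y s)) ∧ HasDerivAt y (F (y s)) s := by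
  have hev (s : ℝ) : ∀ᶠ t in (g : Filter ℝ), 0 ≤ t + s := by
    filter_upwards [hg (eventually_ge_atTop (-s))] with t ht
    linarith
  have hlim (s : ℝ) : ∃ a, Tendsto (fun t => x (t + s)) g (𝓝 a) := by
    obtain ⟨a, -, ha⟩ := hK.ultrafilter_le_nhds (g.map fun t => x (t + s))
      (le_principal_iff.2 ((hev s).mono fun t ht => hxK _ ht))
    exact ⟨a, ha⟩
  choose y hy using hlim
  refine ⟨y, fun s => ⟨hy s, ?_⟩⟩
  obtain ⟨C, hC⟩ := hK.exists_bound_of_continuousOn hF.continuousOn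
  have hlip {t u : ℝ} (ht : 0 ≤ t) (hu : 0 ≤ u) : ‖x u - x t‖ ≤ C * ‖u - t‖ :=
    (convex_Ici (0 : ℝ)).norm_image_sub_le_of_norm_hasDerivWithin_le
      (fun r hr => (hx r hr).hasDerivWithinAt) (fun r hr => hC _ (hxK r hr)) ht hu
  have hunif := hK.uniformContinuousOn_of_continuous hF.continuousOn
  rw [Metric.uniformContinuousOn_iff] at hunif
  rw [hasDerivAt_iff_isLittleO, Asymptotics.isLittleO_iff]
  intro ε hε
  obtain ⟨δ, hδ, hFδ⟩ := hunif ε hε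
  have hC' : 0 < |C| + 1 := by positivity
  filter_upwards [Metric.ball_mem_nhds s (div_pos hδ hC')] with s' hs'
  rw [Metric.mem_ball, Real.dist_eq, lt_div_iff₀ hC'] at hs'
  have htend : Tendsto (fun t => ‖x (t + s') - x (t + s) - (s' - s) • F (x (t + s))‖) g
      (𝓝 ‖y s' - y s - (s' - s) • F (y s)‖) :=
    (((hy s').sub (hy s)).sub (((hF.tendsto _).comp (hy s)).const_smul _)).norm
  refine le_of_tendsto htend ?_
  filter_upwards [hev s, hev s'] with t ht ht'
  have hseg {r : ℝ} (hr : r ∈ Set.uIcc (t + s) (t + s')) : 0 ≤ r :=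
    (le_min ht ht').trans hr.1
  have hmv := (convex_uIcc (t + s) (t + s')).norm_image_sub_le_of_norm_hasDerivWithin_le
    (f := fun r => x r - r • F (x (t + s))) (f' := fun r => F (x r) - F (x (t + s))) (C := ε)
    (fun r hr => by
      simpa using ((hx r (hseg hr)).fun_sub
        ((hasDerivAt_id r).smul_const (F (x (t + s))))).hasDerivWithinAt)
    (fun r hr => by
      rw [← dist_eq_norm]
      refine (hFδ _ (hxK r (hseg hr)) _ (hxK _ ht) ?_).le
      rw [dist_eq_norm]
      have h₁ : ‖r - (t + s)‖ ≤ |s' - s| := by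
        have := Set.abs_sub_left_of_mem_uIcc hr
        rwa [add_sub_add_left_eq_sub] at this
      calc ‖x r - x (t + s)‖ ≤ C * ‖r - (t + s)‖ := hlip ht (hseg hr)
        _ ≤ (|C| + 1) * |s' - s| :=
          mul_le_mul (by linarith [le_abs_self C]) h₁ (norm_nonneg _) hC'.le
        _ < δ := by rwa [mul_comm])
    Set.left_mem_uIcc Set.right_mem_uIcc
  rw [← add_sub_add_left_eq_sub s' s t, sub_smul]
  refine le_of_eq_of_le (congrArg norm ?_) hmv
  abel

/-- A differentiable function that is nonincreasing along a solution staying in a compact set is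
constant along every limit of time translates, so its derivative along the vector field vanishes
there. -/
theorem exists_limit_solution_of_lyapunov {E : Type*} [NormedAddCommGroup E] [NormedSpace ℝ E]
    {F : E → E} (hF : Continuous F) {H : E → ℝ} (hH : Differentiable ℝ H)
    (hpos : ∀ w, 0 ≤ H w) (hcompact : ∀ c, IsCompact {w | H w ≤ c})
    (hdiss : ∀ w, fderiv ℝ H w (F w) ≤ 0) {x : ℝ → E}
    (hx : ∀ t, 0 ≤ t → HasDerivAt x (F (x t)) t)
    (g : Ultrafilter ℝ) (hg : (g : Filter ℝ) ≤ atTop) :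
    ∃ y : ℝ → E, Tendsto x g (𝓝 (y 0)) ∧ ∀ s, HasDerivAt y (F (y s)) s ∧
      fderiv ℝ H (y s) (F (y s)) = 0 := by
  have hHx (t : ℝ) (ht : 0 ≤ t) : HasDerivAt (fun t => H (x t)) (fderiv ℝ H (x t) (F (x t))) t :=
    (hH (x t)).hasFDerivAt.comp_hasDerivAt t (hx t ht)
  have hanti : AntitoneOn (fun t => H (x t)) (Set.Ici 0) := by
    refine antitoneOn_of_hasDerivWithinAt_nonpos (convex_Ici 0)
      (fun t ht => (hHx t ht).continuousAt.continuousWithinAt)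
      (fun t ht => (hHx t (interior_subset ht)).hasDerivWithinAt) fun t _ => hdiss _
  have hanti' : Antitone fun t => H (x (max t 0)) := fun a b hab =>
    hanti (le_max_right a 0) (le_max_right b 0) (max_le_max_right 0 hab)
  have hconv := tendsto_atTop_ciInf hanti' ⟨0, by rintro _ ⟨t, rfl⟩; exact hpos _⟩
  set L := ⨅ t, H (x (max t 0))
  obtain ⟨y, hy⟩ := exists_limit_solution hF (hcompact (H (x 0)))
    (fun t ht => hanti Set.self_mem_Ici ht ht) hx g hg
  have hconst (s : ℝ) : H (y s) = L := by
    refine tendsto_nhds_unique ((hH (y s)).continuousAt.tendsto.comp (hy s).1) ?_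
    refine ((hconv.comp (tendsto_atTop_add_const_right atTop s tendsto_id)).mono_left hg).congr' ?_
    filter_upwards [hg (eventually_ge_atTop (-s))] with t ht
    have : 0 ≤ t + s := by linarith
    simp [max_eq_left this]
  refine ⟨y, by simpa using (hy 0).1, fun s => ⟨(hy s).2, ?_⟩⟩
  have hd := (hH (y s)).hasFDerivAt.comp_hasDerivAt s (hy s).2
  exact (hd.congr_of_eventuallyEq (Eventually.of_forall fun r => (hconst r).symm)).unique
    (hasDerivAt_const s L)

theorem contDiff_hamiltonian {N : ℕ} (G : SimpleGraph (Fin N)) [DecidableRel G.Adj]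
    {U V : ℝ → ℝ} {n : WithTop ℕ∞} (hU : ContDiff ℝ n U) (hV : ContDiff ℝ n V) :
    ContDiff ℝ n (hamiltonian G U V) := by
  unfold hamiltonian
  fun_prop

theorem fderiv_hamiltonian_momentum {N : ℕ} (G : SimpleGraph (Fin N)) [DecidableRel G.Adj]
    {U V : ℝ → ℝ} (hH : Differentiable ℝ (hamiltonian G U V))
    (w : (Fin N → ℝ) × (Fin N → ℝ)) (v : Fin N → ℝ) :
    fderiv ℝ (hamiltonian G U V) w (0, v) = ∑ i, w.2 i * v i := by
  have hline := (hH w).hasFDerivAt.hasLineDerivAt (0, v)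
  refine HasDerivAt.unique hline ?_
  simp only [hamiltonian, Prod.fst_add, Prod.snd_add, Prod.smul_fst, Prod.smul_snd, smul_zero,
    Pi.add_apply, Pi.smul_apply, smul_eq_mul]
  refine HasDerivAt.fun_sum fun i _ => ?_
  have h := ((((hasDerivAt_id (0 : ℝ)).mul_const (v i)).const_add (w.2 i)).pow 2).div_const 2
  refine ((h.add_const _).add_const _).congr_deriv ?_
  simp
  ring

theorem fderiv_hamiltonian_apply {N : ℕ} (G : SimpleGraph (Fin N)) [DecidableRel G.Adj]
    {U V : ℝ → ℝ} (hH : Differentiable ℝ (hamiltonian G U V))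
    (w : (Fin N → ℝ) × (Fin N → ℝ)) (u v : Fin N → ℝ) :
    fderiv ℝ (hamiltonian G U V) w (u, v) =
      ∑ i, (u i * fderiv ℝ (hamiltonian G U V) w (Pi.single i 1, 0) + w.2 i * v i) := by
  have hu : (u, v) = ∑ i, u i • ((Pi.single i 1, 0) : (Fin N → ℝ) × (Fin N → ℝ)) + (0, v) := by
    ext j <;> simp [Prod.fst_sum, Prod.snd_sum, Finset.sum_apply, Pi.single_apply]
  rw [hu, map_add, fderiv_hamiltonian_momentum G hH, map_sum, Finset.sum_add_distrib]
  simp only [map_smul, smul_eq_mul]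

/-- convergence to equilibrium under the stability condition: if `H` has
compact sublevel sets, attains its minimum `0` at the unique point `c₀`, and every
solution of the Hamiltonian flow with momenta vanishing on the damped set is constant
equal to `c₀`, then every solution of the damped system converges to `c₀`. -/
theorem stmt13 (N : ℕ) (hN : 0 < N) (G : SimpleGraph (Fin N)) [DecidableRel G.Adj]
    (hG : G.Connected)
    (U V : ℝ → ℝ)
    (hUpoly : ∃ P : Polynomial ℝ, U = fun x => P.eval x)
    (hVpoly : ∃ P : Polynomial ℝ, V = fun x => P.eval x)
    (hUconv : ConvexOn ℝ Set.univ U) (hVconv : ConvexOn ℝ Set.univ V)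
    (D : Finset (Fin N)) (hD : D.Nonempty)
    (H : (Fin N → ℝ) × (Fin N → ℝ) → ℝ) (hH : H = hamiltonian G U V)
    (hcompact : ∀ c : ℝ, IsCompact {w : (Fin N → ℝ) × (Fin N → ℝ) | H w ≤ c})
    (c₀ : (Fin N → ℝ) × (Fin N → ℝ))
    (hmin : H c₀ = 0) (hpos : ∀ w, 0 ≤ H w) (huniq : ∀ w, H w = 0 → w = c₀)
    (hstab : ∀ q p : ℝ → Fin N → ℝ,
      (∀ (t : ℝ) (i : Fin N), HasDerivAt (fun s => q s i) (p t i) t) →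
      (∀ (t : ℝ) (i : Fin N),
        HasDerivAt (fun s => p s i) (-(fderiv ℝ H (q t, p t) (Pi.single i 1, 0))) t) →
      (∀ i ∈ D, ∀ t : ℝ, p t i = 0) →
      ∀ t : ℝ, (q t, p t) = c₀)
    (q p : ℝ → Fin N → ℝ)
    (hq : ∀ t ∈ Set.Ici (0 : ℝ), ∀ i : Fin N, HasDerivAt (fun s => q s i) (p t i) t)
    (hp : ∀ t ∈ Set.Ici (0 : ℝ), ∀ i : Fin N,
      HasDerivAt (fun s => p s i)
        (-(fderiv ℝ H (q t, p t) (Pi.single i 1, 0)) - (if i ∈ D then 1 else 0) * p t i) t) :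
    Tendsto (fun t : ℝ => (q t, p t)) atTop (nhds c₀) := by
  have hU : ContDiff ℝ 1 U := by
    obtain ⟨P, rfl⟩ := hUpoly
    simpa only [Polynomial.coe_aeval_eq_eval] using P.contDiff_aeval (𝕜 := ℝ) 1
  have hV : ContDiff ℝ 1 V := by
    obtain ⟨P, rfl⟩ := hVpoly
    simpa only [Polynomial.coe_aeval_eq_eval] using P.contDiff_aeval (𝕜 := ℝ) 1
  have hC : ContDiff ℝ 1 H := hH ▸ contDiff_hamiltonian G hU hV
  have hdiff : Differentiable ℝ H := hC.differentiable one_ne_zero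
  let F : (Fin N → ℝ) × (Fin N → ℝ) → (Fin N → ℝ) × (Fin N → ℝ) := fun w =>
    (w.2, fun i => -(fderiv ℝ H w (Pi.single i 1, 0)) - (if i ∈ D then 1 else 0) * w.2 i)
  have hF : Continuous F := by
    have := hC.continuous_fderiv one_ne_zero
    fun_prop
  have hdiss (w : (Fin N → ℝ) × (Fin N → ℝ)) :
      fderiv ℝ H w (F w) = -∑ i ∈ D, w.2 i ^ 2 := by
    have h := fderiv_hamiltonian_apply G (hH ▸ hdiff) w (F w).1 (F w).2
    rw [← hH] at h
    rw [← Prod.mk.eta (p := F w), h, ← Finset.sum_neg_distrib,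
      ← Finset.sum_subset D.subset_univ (f := fun i =>
        (F w).1 i * fderiv ℝ H w (Pi.single i 1, 0) + w.2 i * (F w).2 i)]
    · refine Finset.sum_congr rfl fun i hi => ?_
      simp only [F, hi, if_true]
      ring
    · intro i _ hi
      simp only [F, hi, if_false]
      ring
  rw [tendsto_iff_ultrafilter]
  intro g hg
  obtain ⟨y, hy₀, hy⟩ := exists_limit_solution_of_lyapunov hF hdiff hpos hcompact
    (fun w => by rw [hdiss]; exact neg_nonpos.2 (Finset.sum_nonneg fun i _ => sq_nonneg _))
    (x := fun t => (q t, p t))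
    (fun t ht => (hasDerivAt_pi.2 (hq t ht)).prodMk (hasDerivAt_pi.2 (hp t ht))) g hg
  have hD₀ : ∀ i ∈ D, ∀ t, (y t).2 i = 0 := by
    intro i hi t
    have h := (hy t).2
    rw [hdiss, neg_eq_zero, Finset.sum_eq_zero_iff_of_nonneg fun i _ => sq_nonneg _] at h
    exact pow_eq_zero_iff two_ne_zero |>.1 (h i hi)
  have hyc := hstab (fun t => (y t).1) (fun t => (y t).2)
    (fun t i => hasDerivAt_pi.1 (hasFDerivAt_fst.comp_hasDerivAt t (hy t).1) i)
    (fun t i => by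
      refine (hasDerivAt_pi.1 (hasFDerivAt_snd.comp_hasDerivAt t (hy t).1) i).congr_deriv ?_
      by_cases hi : i ∈ D <;> simp [F, hi, hD₀])
    hD₀ 0
  exact hyc ▸ hy₀
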